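/- Let α > 0 and 1 < p < ∞ with p ≠ Q, where Q = m + (α+1)k, and assume Q > p. Set ω_{α,p} = ∫_{{ρ<1}} (Φ⁰(z)/ρ(z,σ))^{αp} dz dσ, σ_{α,p} = Q ω_{α,p}, C_{α,p} = ((p−1)/(Q−p)) σ_{α,p}^{−1/(p−1)}, and 𝒢(z,σ) = C_{α,p} ρ(z,σ)^{−(Q−p)/(p−1)}. Then for every φ ∈ C_c^∞(ℝ^N): ∫_{ℝ^N} (Φ(∇_z 𝒢)² + (Φ⁰(z)^{2α}/4)Ψ(∇_σ 𝒢)²)^{(p−2)/2} ( Φ(∇_z 𝒢)⟨∇Φ(∇_z 𝒢), ∇_z φ⟩ + (Φ⁰(z)^{2α}/4)Ψ(∇_σ 𝒢)⟨∇Ψ(∇_σ 𝒢), ∇_σ φ⟩ ) dz dσ = φ(0,0); i.e., 𝒢 is a fundamental solution of −𝓛_{α,p} with pole at the origin. -/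

import Mathlib

open Real MeasureTheory
open scoped RealInnerProductSpace

noncomputable section

abbrev Euc (n : ℕ) := EuclideanSpace ℝ (Fin n)

/-- A Minkowski norm on `ℝⁿ`: nonnegative, absolutely homogeneous, with `N²` of class `C²`
away from the origin and strictly convex. -/
def IsMinkowskiNorm {n : ℕ} (N : Euc n → ℝ) : Prop :=
  (∀ x, 0 ≤ N x) ∧ (∀ (l : ℝ) (x : Euc n), N (l • x) = |l| * N x) ∧
  ContDiffOn ℝ 2 (fun x => (N x) ^ 2) {(0 : Euc n)}ᶜ ∧
  StrictConvexOn ℝ Set.univ (fun x => (N x) ^ 2)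

/-- The Legendre transform (dual norm) `N⁰(x) = sup { ⟨x,ξ⟩ : N(ξ) = 1 }`. -/
def dualNorm {n : ℕ} (N : Euc n → ℝ) (x : Euc n) : ℝ :=
  sSup ((fun ξ => ⟪x, ξ⟫) '' {ξ | N ξ = 1})

variable {m k : ℕ}

/-- The dual anisotropic Minkowski gauge
`ρ(z,σ) = (Φ⁰(z)^{2(α+1)} + 4(α+1)²Ψ⁰(σ)²)^{1/(2(α+1))}`. -/
def rho (α : ℝ) (Φ : Euc m → ℝ) (Ψ : Euc k → ℝ) (x : Euc m × Euc k) : ℝ :=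
  (dualNorm Φ x.1 ^ (2 * (α + 1)) + 4 * (α + 1) ^ 2 * dualNorm Ψ x.2 ^ 2) ^ (1 / (2 * (α + 1)))

/-- Gradient in the `z` variables. -/
def gradZ (u : Euc m × Euc k → ℝ) (x : Euc m × Euc k) : Euc m :=
  gradient (fun z => u (z, x.2)) x.1

/-- Gradient in the `σ` variables. -/
def gradS (u : Euc m × Euc k → ℝ) (x : Euc m × Euc k) : Euc k :=
  gradient (fun σ => u (x.1, σ)) x.2

/-- Divergence in the `z` variables. -/
def divZ (V : Euc m × Euc k → Euc m) (x : Euc m × Euc k) : ℝ :=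
  ∑ i, fderiv ℝ (fun z => V (z, x.2) i) x.1 (EuclideanSpace.single i 1)

/-- Divergence in the `σ` variables. -/
def divS (V : Euc m × Euc k → Euc k) (x : Euc m × Euc k) : ℝ :=
  ∑ i, fderiv ℝ (fun σ => V (x.1, σ) i) x.2 (EuclideanSpace.single i 1)

/-- The Finsler Laplacian in the `z` variables, `Δ_Φ(u) = div_z(Φ(∇_z u) ∇Φ(∇_z u))`. -/
def finslerLapZ (Φ : Euc m → ℝ) (u : Euc m × Euc k → ℝ) (x : Euc m × Euc k) : ℝ :=
  divZ (fun y => Φ (gradZ u y) • gradient Φ (gradZ u y)) x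

/-- The Finsler Laplacian in the `σ` variables, `Δ_Ψ(u) = div_σ(Ψ(∇_σ u) ∇Ψ(∇_σ u))`. -/
def finslerLapS (Ψ : Euc k → ℝ) (u : Euc m × Euc k → ℝ) (x : Euc m × Euc k) : ℝ :=
  divS (fun y => Ψ (gradS u y) • gradient Ψ (gradS u y)) x

/-- The operator `𝓛_{α,p}`. -/
def Lop (α p : ℝ) (Φ : Euc m → ℝ) (Ψ : Euc k → ℝ) (u : Euc m × Euc k → ℝ)
    (x : Euc m × Euc k) : ℝ :=
  divZ (fun y =>
      (Φ (gradZ u y) ^ 2 + dualNorm Φ y.1 ^ (2 * α) / 4 * Ψ (gradS u y) ^ 2) ^ ((p - 2) / 2) •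
        (Φ (gradZ u y) • gradient Φ (gradZ u y))) x
  + divS (fun y =>
      (Φ (gradZ u y) ^ 2 + dualNorm Φ y.1 ^ (2 * α) / 4 * Ψ (gradS u y) ^ 2) ^ ((p - 2) / 2) •
        ((dualNorm Φ y.1 ^ (2 * α) / 4 * Ψ (gradS u y)) • gradient Ψ (gradS u y))) x

/-- The operator `𝓛_{α,2}(u) = Δ_Φ(u) + (Φ⁰(z)^{2α}/4) Δ_Ψ(u)`. -/
def Lop2 (α : ℝ) (Φ : Euc m → ℝ) (Ψ : Euc k → ℝ) (u : Euc m × Euc k → ℝ)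
    (x : Euc m × Euc k) : ℝ :=
  finslerLapZ Φ u x + dualNorm Φ x.1 ^ (2 * α) / 4 * finslerLapS Ψ u x

open Filter Topology

namespace IsMinkowskiNorm

variable {n : ℕ} {N : Euc n → ℝ}

lemma map_zero (hN : IsMinkowskiNorm N) : N 0 = 0 := by
  simpa using hN.2.1 0 0

lemma map_neg (hN : IsMinkowskiNorm N) (x : Euc n) : N (-x) = N x := by
  simpa using hN.2.1 (-1) x

lemma pos (hN : IsMinkowskiNorm N) {x : Euc n} (hx : x ≠ 0) : 0 < N x := by
  have hne : x ≠ -x := fun h => hx <| by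
    have h2 : (2 : ℝ) • x = 0 := by rw [two_smul, ← eq_neg_iff_add_eq_zero]; exact h
    simpa using h2
  have h := hN.2.2.2.2 (Set.mem_univ x) (Set.mem_univ (-x)) hne
    (show (0 : ℝ) < 1 / 2 by norm_num) (show (0 : ℝ) < 1 / 2 by norm_num) (by norm_num)
  simp only [smul_neg, add_neg_cancel, hN.map_zero, hN.map_neg, smul_eq_mul] at h
  refine lt_of_le_of_ne (hN.1 x) fun h0 => ?_
  rw [← h0] at h
  norm_num at h

lemma continuous (hN : IsMinkowskiNorm N) : Continuous N := by
  have h : Continuous fun x => N x ^ 2 :=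
    continuousOn_univ.mp (hN.2.2.2.convexOn.continuousOn isOpen_univ)
  have h2 : N = fun x => √(N x ^ 2) := by
    ext x
    rw [Real.sqrt_sq (hN.1 x)]
  rw [h2]
  exact h.sqrt

lemma exists_le_norm (hN : IsMinkowskiNorm N) : ∃ c, 0 < c ∧ ∀ x, N x ≤ c * ‖x‖ := by
  obtain ⟨c, hc⟩ := (isCompact_sphere (0 : Euc n) 1).bddAbove_image hN.continuous.continuousOn
  refine ⟨max c 1, by positivity, fun x => ?_⟩
  rcases eq_or_ne x 0 with rfl | hx
  · simp [hN.map_zero]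
  have hx' : 0 < ‖x‖ := norm_pos_iff.mpr hx
  have h1 : N (‖x‖⁻¹ • x) ≤ c := hc ⟨_, by simp [norm_smul, hx'.ne'], rfl⟩
  rw [hN.2.1, abs_of_pos (by positivity), inv_mul_le_iff₀ hx', mul_comm] at h1
  exact h1.trans (by gcongr; exact le_max_left _ _)

lemma exists_norm_le (hN : IsMinkowskiNorm N) : ∃ b, 0 < b ∧ ∀ x, ‖x‖ ≤ b * N x := by
  have hcont : ContinuousOn (fun x => (N x)⁻¹) (Metric.sphere (0 : Euc n) 1) :=
    hN.continuous.continuousOn.inv₀ fun x hx => (hN.pos (by rintro rfl; simp at hx)).ne'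
  obtain ⟨b, hb⟩ := (isCompact_sphere (0 : Euc n) 1).bddAbove_image hcont
  refine ⟨max b 1, by positivity, fun x => ?_⟩
  rcases eq_or_ne x 0 with rfl | hx
  · simp [hN.map_zero]
  have hx' : 0 < ‖x‖ := norm_pos_iff.mpr hx
  have h1 : (N (‖x‖⁻¹ • x))⁻¹ ≤ b := hb ⟨_, by simp [norm_smul, hx'.ne'], rfl⟩
  rw [hN.2.1, abs_of_pos (by positivity), mul_inv, inv_inv, ← div_eq_mul_inv,
    div_le_iff₀ (hN.pos hx)] at h1
  exact h1.trans (mul_le_mul_of_nonneg_right (le_max_left _ _) (hN.1 x))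

lemma isCompact_unitSphere (hN : IsMinkowskiNorm N) : IsCompact {ξ | N ξ = 1} := by
  obtain ⟨b, -, hb⟩ := hN.exists_norm_le
  refine Metric.isCompact_of_isClosed_isBounded (isClosed_eq hN.continuous continuous_const)
    (isBounded_iff_forall_norm_le.mpr ⟨b, fun x hx => ?_⟩)
  simpa [show N x = 1 from hx] using hb x

lemma map_normalize (hN : IsMinkowskiNorm N) {x : Euc n} (hx : x ≠ 0) :
    N ((N x)⁻¹ • x) = 1 := by
  have h := hN.pos hx
  rw [hN.2.1, abs_of_pos (by positivity), inv_mul_cancel₀ h.ne']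

lemma bddAbove_dual (hN : IsMinkowskiNorm N) (x : Euc n) :
    BddAbove ((fun ξ => ⟪x, ξ⟫) '' {ξ | N ξ = 1}) :=
  hN.isCompact_unitSphere.bddAbove_image (by fun_prop)

lemma inner_le_dualNorm (hN : IsMinkowskiNorm N) (x ξ : Euc n) :
    ⟪x, ξ⟫ ≤ dualNorm N x * N ξ := by
  rcases eq_or_ne ξ 0 with rfl | hξ
  · simp [hN.map_zero]
  have h := le_csSup (hN.bddAbove_dual x) ⟨_, hN.map_normalize hξ, rfl⟩
  simp only [inner_smul_right] at h
  rwa [inv_mul_le_iff₀ (hN.pos hξ), mul_comm] at h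

lemma dualNorm_zero : dualNorm N 0 = 0 := by
  refine le_antisymm (Real.sSup_le ?_ le_rfl) (Real.sSup_nonneg ?_) <;>
  · rintro _ ⟨ξ, -, rfl⟩
    simp

lemma dualNorm_pos (hN : IsMinkowskiNorm N) {x : Euc n} (hx : x ≠ 0) : 0 < dualNorm N x := by
  have h := hN.inner_le_dualNorm x x
  have h2 : 0 < ⟪x, x⟫ := real_inner_self_pos.mpr hx
  exact pos_of_mul_pos_left (h2.trans_le h) (hN.1 x)

lemma dualNorm_nonneg (hN : IsMinkowskiNorm N) (x : Euc n) : 0 ≤ dualNorm N x := by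
  rcases eq_or_ne x 0 with rfl | hx
  · exact dualNorm_zero.ge
  · exact (hN.dualNorm_pos hx).le

lemma dualNorm_smul {t : ℝ} (ht : 0 ≤ t) (x : Euc n) :
    dualNorm N (t • x) = t * dualNorm N x := by
  unfold dualNorm
  rw [← smul_eq_mul, ← Real.sSup_smul_of_nonneg ht, ← Set.image_smul, Set.image_image]
  simp only [real_inner_smul_left, smul_eq_mul]

lemma exists_norm_le_dualNorm (hN : IsMinkowskiNorm N) :
    ∃ c, 0 < c ∧ ∀ x, ‖x‖ ≤ c * dualNorm N x := by
  obtain ⟨c, hc, h⟩ := hN.exists_le_norm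
  refine ⟨c, hc, fun x => ?_⟩
  rcases eq_or_ne x 0 with rfl | hx
  · simp [dualNorm_zero]
  have hx' : 0 < ‖x‖ := norm_pos_iff.mpr hx
  have h1 := hN.inner_le_dualNorm x x
  rw [real_inner_self_eq_norm_sq] at h1
  have h2 := mul_le_mul_of_nonneg_left (h x) (hN.dualNorm_nonneg x)
  nlinarith

lemma continuous_dualNorm (hN : IsMinkowskiNorm N) : Continuous (dualNorm N) := by
  obtain ⟨b, hb0, hb⟩ := hN.exists_norm_le
  refine (LipschitzWith.of_le_add_mul b.toNNReal fun x y => ?_).continuous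
  rw [Real.coe_toNNReal _ hb0.le]
  refine Real.sSup_le ?_ (add_nonneg (hN.dualNorm_nonneg y) (by positivity))
  rintro _ ⟨ξ, hξ, rfl⟩
  have hξ : N ξ = 1 := hξ
  have h1 := hN.inner_le_dualNorm y ξ
  have h2 := real_inner_le_norm (x - y) ξ
  have h3 := mul_le_mul_of_nonneg_left (hb ξ) (norm_nonneg (x - y))
  rw [inner_sub_left] at h2
  rw [hξ, mul_one] at h1 h3
  rw [dist_eq_norm]
  show ⟪x, ξ⟫ ≤ _
  linarith

lemma exists_maximizer (hN : IsMinkowskiNorm N) (hn : 1 ≤ n) (x : Euc n) :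
    ∃ ξ, N ξ = 1 ∧ ⟪x, ξ⟫ = dualNorm N x := by
  have : NeZero n := ⟨by omega⟩
  obtain ⟨v, hv⟩ := exists_ne (0 : Euc n)
  obtain ⟨ξ, hξ, h⟩ := hN.isCompact_unitSphere.exists_sSup_image_eq
    ⟨_, hN.map_normalize hv⟩ (f := fun ξ => ⟪x, ξ⟫) (by fun_prop)
  exact ⟨ξ, hξ, h.symm⟩

lemma maximizer_unique (hN : IsMinkowskiNorm N) {x ξ η : Euc n} (hx : x ≠ 0)
    (hξ : N ξ = 1) (hξx : ⟪x, ξ⟫ = dualNorm N x) (hη : N η = 1)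
    (hηx : ⟪x, η⟫ = dualNorm N x) : ξ = η := by
  by_contra hne
  have h := hN.2.2.2.2 (Set.mem_univ ξ) (Set.mem_univ η) hne
    (show (0 : ℝ) < 1 / 2 by norm_num) (show (0 : ℝ) < 1 / 2 by norm_num) (by norm_num)
  simp only [hξ, hη, smul_eq_mul] at h
  have h1 := hN.inner_le_dualNorm x ((1 / 2 : ℝ) • ξ + (1 / 2 : ℝ) • η)
  rw [inner_add_right, inner_smul_right, inner_smul_right, hξx, hηx] at h1
  have h2 := hN.dualNorm_pos hx
  have h3 := hN.1 ((1 / 2 : ℝ) • ξ + (1 / 2 : ℝ) • η)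
  nlinarith

/-- The dual of a Minkowski norm is differentiable away from the origin, its gradient being the
unique maximizer of the defining supremum. -/
lemma hasGradientAt_dualNorm (hN : IsMinkowskiNorm N) (hn : 1 ≤ n) {x ξ : Euc n} (hx : x ≠ 0)
    (hξ : N ξ = 1) (hξx : ⟪x, ξ⟫ = dualNorm N x) : HasGradientAt (dualNorm N) ξ x := by
  choose g hg1 hg2 using hN.exists_maximizer hn
  have hgx : Tendsto g (𝓝 x) (𝓝 ξ) := by
    refine hN.isCompact_unitSphere.tendsto_nhds_of_unique_mapClusterPt
      (Eventually.of_forall hg1) fun η hη hcl => ?_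
    refine hN.maximizer_unique hx hη ?_ hξ hξx
    have h1 : MapClusterPt (⟪x, η⟫ - dualNorm N x) (𝓝 x) fun y => ⟪x, g y⟫ - dualNorm N x :=
      hcl.continuousAt_comp (F := 𝓝 x) (f := fun ζ => ⟪x, ζ⟫ - dualNorm N x)
        (Continuous.continuousAt (by fun_prop))
    have h2 : Tendsto (fun y => ⟪x, g y⟫ - dualNorm N x) (𝓝 x) (𝓝 0) := by
      obtain ⟨b, -, hb⟩ := hN.exists_norm_le
      have h3 : Tendsto (fun y => ‖x - y‖ * b + |dualNorm N y - dualNorm N x|) (𝓝 x) (𝓝 0) := by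
        have := hN.continuous_dualNorm
        refine Continuous.tendsto' (by fun_prop) _ _ (by simp)
      refine squeeze_zero_norm (fun y => ?_) h3
      have h4 : ⟪x, g y⟫ - dualNorm N x = ⟪x - y, g y⟫ + (dualNorm N y - dualNorm N x) := by
        rw [inner_sub_left, hg2]; ring
      rw [h4]
      refine (norm_add_le _ _).trans (add_le_add ?_ le_rfl)
      refine (norm_inner_le_norm _ _).trans (mul_le_mul_of_nonneg_left ?_ (norm_nonneg _))
      simpa [hg1] using hb (g y)
    exact sub_eq_zero.mp (eq_of_nhds_neBot (ClusterPt.mono h1 h2))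
  rw [hasGradientAt_iff_hasFDerivAt, hasFDerivAt_iff_isLittleO, Asymptotics.isLittleO_iff]
  intro c hc
  have h5 : ∀ᶠ y in 𝓝 x, ‖g y - ξ‖ < c := by
    have := (tendsto_iff_norm_sub_tendsto_zero.mp hgx)
    exact this.eventually_lt_const hc
  filter_upwards [h5] with y hy
  have h6 := hN.inner_le_dualNorm y ξ
  have h7 := hN.inner_le_dualNorm x (g y)
  rw [hξ, mul_one] at h6
  rw [hg1, mul_one] at h7
  have h8 := real_inner_le_norm (y - x) (g y - ξ)
  have h9 := mul_le_mul_of_nonneg_left hy.le (norm_nonneg (y - x))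
  have h10 : ⟪y - x, g y - ξ⟫ = dualNorm N y - ⟪x, g y⟫ - ⟪y, ξ⟫ + dualNorm N x := by
    rw [inner_sub_left, inner_sub_right, inner_sub_right, hg2, hξx]; ring
  have h11 : InnerProductSpace.toDual ℝ (Euc n) ξ (y - x) = ⟪y, ξ⟫ - dualNorm N x := by
    rw [InnerProductSpace.toDual_apply_apply, real_inner_comm, inner_sub_left, hξx]
  rw [h11, Real.norm_eq_abs, abs_le]
  constructor <;> nlinarith

lemma differentiableAt (hN : IsMinkowskiNorm N) {x : Euc n} (hx : x ≠ 0) :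
    DifferentiableAt ℝ N x := by
  have h1 : DifferentiableAt ℝ (fun x => N x ^ 2) x :=
    (hN.2.2.1.contDiffAt (isOpen_compl_singleton.mem_nhds hx)).differentiableAt (by norm_num)
  have h2 : N = fun x => √(N x ^ 2) := by
    ext x
    rw [Real.sqrt_sq (hN.1 x)]
  rw [h2]
  exact h1.sqrt (pow_pos (hN.pos hx) 2).ne'

/-- Legendre duality: at a negative multiple of the gradient of the dual norm at `x`, the gradient
of `N` is `-x` divided by the dual norm of `x`. -/
lemma gradient_neg_smul_maximizer (hN : IsMinkowskiNorm N) {x ξ : Euc n} (hx : x ≠ 0)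
    (hξ : N ξ = 1) (hξx : ⟪x, ξ⟫ = dualNorm N x) {s : ℝ} (hs : 0 < s) :
    gradient N (-(s • ξ)) = -((dualNorm N x)⁻¹ • x) := by
  have hξ0 : ξ ≠ 0 := by
    rintro rfl
    simp [hN.map_zero] at hξ
  have hne : -(s • ξ) ≠ 0 := neg_ne_zero.mpr (smul_ne_zero hs.ne' hξ0)
  have hd := (hN.differentiableAt hne).hasGradientAt.hasFDerivAt
  have hpos := hN.dualNorm_pos hx
  have hd2 : HasFDerivAt (fun η => dualNorm N x * N η + ⟪x, η⟫) _ (-(s • ξ)) :=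
    (hd.const_mul (dualNorm N x)).add (innerSL ℝ x).hasFDerivAt
  have hmin : IsLocalMin (fun η => dualNorm N x * N η + ⟪x, η⟫) (-(s • ξ)) := by
    refine Eventually.of_forall fun η => ?_
    have h1 := hN.inner_le_dualNorm x (-η)
    rw [hN.map_neg, inner_neg_right] at h1
    simp only [hN.map_neg, hN.2.1, hξ, abs_of_pos hs, inner_neg_right, inner_smul_right, hξx]
    linarith
  have h0 := hmin.hasFDerivAt_eq_zero hd2
  have h1 : dualNorm N x • gradient N (-(s • ξ)) + x = 0 := by
    refine ext_inner_right ℝ fun v => ?_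
    simpa [inner_add_left, real_inner_smul_left] using DFunLike.congr_fun h0 v
  rw [← smul_neg (dualNorm N x)⁻¹, eq_inv_smul_iff₀ hpos.ne']
  exact eq_neg_of_add_eq_zero_left h1

end IsMinkowskiNorm

/-- The anisotropic dilations `(z, σ) ↦ (t z, t^{α+1} σ)`. -/
def dilation (α t : ℝ) (x : Euc m × Euc k) : Euc m × Euc k :=
  (t • x.1, t ^ (α + 1) • x.2)

lemma measurable_dilation (α : ℝ) :
    Measurable fun q : (Euc m × Euc k) × ℝ => dilation α q.2 q.1 := by
  unfold dilation
  fun_prop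

lemma volume_preimage_dilation {α Q : ℝ} (hQ : Q = (m : ℝ) + (α + 1) * (k : ℝ)) {t : ℝ}
    (ht : 0 < t) {S : Set (Euc m × Euc k)} (hS : MeasurableSet S) :
    volume (dilation α t ⁻¹' S) = ENNReal.ofReal (t ^ (-Q)) * volume S := by
  have hmeas : Measurable (dilation (m := m) (k := k) α t) := by
    unfold dilation
    fun_prop
  have hmap : Measure.map (dilation (m := m) (k := k) α t) volume =
      ENNReal.ofReal (t ^ (-Q)) • volume := by
    have h1 := Measure.map_prod_map (volume : Measure (Euc m)) (volume : Measure (Euc k))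
      (measurable_const_smul t) (measurable_const_smul (t ^ (α + 1)))
    rw [Measure.map_addHaar_smul _ ht.ne',
      Measure.map_addHaar_smul _ (Real.rpow_pos_of_pos ht _).ne',
      Measure.prod_smul_left, Measure.prod_smul_right, smul_smul] at h1
    refine Eq.trans h1.symm ?_
    rw [← ENNReal.ofReal_mul (abs_nonneg _), finrank_euclideanSpace_fin, finrank_euclideanSpace_fin,
      abs_of_nonneg (by positivity), abs_of_nonneg (by positivity), ← Real.rpow_natCast,
      ← Real.rpow_natCast, ← Real.rpow_mul ht.le, ← mul_inv, ← Real.rpow_add ht,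
      ← Real.rpow_neg ht.le, hQ]
    rfl
  rw [← Measure.map_apply hmeas hS, hmap, Measure.smul_apply, smul_eq_mul]

lemma lintegral_Ioi_mul_rpow {Q r : ℝ} (hQ : 0 < Q) (hr : 0 < r) :
    ∫⁻ t in Set.Ioi r, ENNReal.ofReal (Q * t ^ (-Q - 1)) = ENNReal.ofReal (r ^ (-Q)) := by
  rw [← ofReal_integral_eq_lintegral_ofReal
    ((integrableOn_Ioi_rpow_of_lt (by linarith) hr).const_mul Q), integral_const_mul,
    integral_Ioi_rpow_of_lt (by linarith) hr]
  · congr 1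
    rw [sub_add_cancel]
    field_simp
  · filter_upwards [ae_restrict_mem measurableSet_Ioi] with t ht
    have : 0 < t := hr.trans ht
    simp only [Pi.zero_apply]
    positivity

/-- Polar coordinates for the dilations: `ρ^{-Q} dx` is the image of `dx ⊗ Q dt / t` on
`{ρ < 1} × (0, ∞)` under `(x, t) ↦ δ_t x`. -/
lemma map_dilation_prod {α Q : ℝ} (hQ : Q = (m : ℝ) + (α + 1) * (k : ℝ)) (hQ0 : 0 < Q)
    {r : Euc m × Euc k → ℝ} (hr : Measurable r) (hr0 : ∀ᵐ x, 0 < r x)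
    (hrd : ∀ t, 0 < t → ∀ x, r (dilation α t x) = t * r x) :
    Measure.map (fun q : (Euc m × Euc k) × ℝ => dilation α q.2 q.1)
      ((volume.restrict {x | r x < 1}).prod
        ((volume.restrict (Set.Ioi 0)).withDensity fun t => ENNReal.ofReal (Q * t⁻¹))) =
      volume.withDensity fun x => ENNReal.ofReal (r x ^ (-Q)) := by
  ext S hS
  rw [Measure.map_apply (measurable_dilation α) hS,
    Measure.prod_apply_symm (measurable_dilation α hS),
    lintegral_withDensity_eq_lintegral_mul _ (by fun_prop)
      (measurable_measure_prodMk_right (measurable_dilation α hS)), withDensity_apply _ hS]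
  have hKm : Measurable (Function.uncurry fun (t : ℝ) (x : Euc m × Euc k) =>
      (Set.Ioi (r x)).indicator (fun t => ENNReal.ofReal (Q * t ^ (-Q - 1))) t) := by
    have : (Function.uncurry fun (t : ℝ) (x : Euc m × Euc k) =>
        (Set.Ioi (r x)).indicator (fun t => ENNReal.ofReal (Q * t ^ (-Q - 1))) t) =
        {q : ℝ × Euc m × Euc k | r q.2 < q.1}.indicator
          (fun q => ENNReal.ofReal (Q * q.1 ^ (-Q - 1))) := by
      ext q
      simp [Function.uncurry, Set.indicator]
    rw [this]
    exact Measurable.indicator (by fun_prop)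
      (measurableSet_lt (hr.comp measurable_snd) measurable_fst)
  have h1 : ∀ t ∈ Set.Ioi (0 : ℝ),
      ((fun t => ENNReal.ofReal (Q * t⁻¹)) * fun t => (volume.restrict {x | r x < 1})
        ((fun x => (x, t)) ⁻¹' ((fun q : (Euc m × Euc k) × ℝ => dilation α q.2 q.1) ⁻¹' S))) t =
      ∫⁻ x in S, (Set.Ioi (r x)).indicator (fun t => ENNReal.ofReal (Q * t ^ (-Q - 1))) t := by
    intro t ht
    have ht : 0 < t := ht
    have hset : (fun x => (x, t)) ⁻¹'
        ((fun q : (Euc m × Euc k) × ℝ => dilation α q.2 q.1) ⁻¹' S) ∩ {x | r x < 1} =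
        dilation α t ⁻¹' (S ∩ {x | r x < t}) := by
      ext x
      simp only [Set.mem_inter_iff, Set.mem_preimage, Set.mem_ofPred_eq, hrd t ht]
      refine and_congr_right fun _ => ?_
      constructor <;> intro h <;> nlinarith
    have hlt : MeasurableSet {x | r x < t} := measurableSet_lt hr measurable_const
    rw [Pi.mul_apply, Measure.restrict_apply
      (measurable_prodMk_right (measurable_dilation α hS)), hset,
      volume_preimage_dilation hQ ht (hS.inter hlt), ← mul_assoc,
      ← ENNReal.ofReal_mul (by positivity)]
    have hind : (fun x => (Set.Ioi (r x)).indicator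
        (fun t => ENNReal.ofReal (Q * t ^ (-Q - 1))) t) =
        {x | r x < t}.indicator fun _ => ENNReal.ofReal (Q * t ^ (-Q - 1)) := by
      ext x
      simp [Set.indicator]
    rw [hind, lintegral_indicator hlt, setLIntegral_const, Measure.restrict_apply hlt,
      Set.inter_comm]
    congr 2
    rw [Real.rpow_sub_one ht.ne']
    ring
  rw [setLIntegral_congr_fun measurableSet_Ioi h1, lintegral_lintegral_swap hKm.aemeasurable]
  refine lintegral_congr_ae ?_
  filter_upwards [ae_restrict_of_ae hr0] with x hx
  rw [lintegral_indicator measurableSet_Ioi, Measure.restrict_restrict measurableSet_Ioi,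
    Set.inter_eq_left.mpr (Set.Ioi_subset_Ioi hx.le), lintegral_Ioi_mul_rpow hQ0 hx]

lemma hasDerivAt_dilation (α : ℝ) (x : Euc m × Euc k) {t : ℝ} (ht : 0 < t) :
    HasDerivAt (fun t => dilation α t x)
      (t⁻¹ • ((dilation α t x).1, (α + 1) • (dilation α t x).2)) t := by
  have h1 : HasDerivAt (fun t : ℝ => t • x.1) ((1 : ℝ) • x.1) t :=
    (hasDerivAt_id t).smul_const x.1
  have h2 : HasDerivAt (fun t : ℝ => t ^ (α + 1) • x.2) (((α + 1) * t ^ (α + 1 - 1)) • x.2) t :=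
    (Real.hasDerivAt_rpow_const (Or.inl ht.ne')).smul_const x.2
  refine (h1.prodMk h2).congr_deriv (Prod.ext ?_ ?_)
  · simp only [dilation, Prod.smul_mk, smul_smul, inv_mul_cancel₀ ht.ne']
  · simp only [dilation, Prod.smul_mk, smul_smul, Real.rpow_sub_one ht.ne']
    congr 1
    ring

lemma volume_setOf_lt_one_lt_top {α : ℝ} (hα : 0 < α) {r : Euc m × Euc k → ℝ}
    (hrn : ∀ x, 0 ≤ r x) {c : ℝ} (hc : 0 < c) (hc1 : ∀ x, ‖x.1‖ ≤ c * r x)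
    (hc2 : ∀ x, ‖x.2‖ ≤ c * r x ^ (α + 1)) : volume {x | r x < 1} < ⊤ := by
  refine (measure_mono fun x hx => ?_).trans_lt
    (isCompact_closedBall (0 : Euc m × Euc k) c).measure_lt_top
  have hx : r x < 1 := hx
  rw [mem_closedBall_zero_iff, Prod.norm_def]
  refine max_le ((hc1 x).trans (mul_le_of_le_one_right hc.le hx.le)) ((hc2 x).trans ?_)
  exact mul_le_of_le_one_right hc.le (Real.rpow_le_one (hrn x) hx.le (by linarith))

/-- A weight `w` homogeneous of degree zero, integrated against `r^{-Q}` times the derivative of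
`φ` along the generator of the dilations, returns the value of `φ` at the origin. -/
lemma integral_rpow_mul_fderiv_generator {α Q : ℝ} (hα : 0 < α)
    (hQ : Q = (m : ℝ) + (α + 1) * (k : ℝ)) (hQ0 : 0 < Q)
    {r w φ : Euc m × Euc k → ℝ} (hr : Continuous r) (hr0 : ∀ᵐ x, 0 < r x) (hrn : ∀ x, 0 ≤ r x)
    (hrd : ∀ t, 0 < t → ∀ x, r (dilation α t x) = t * r x)
    {c : ℝ} (hc : 0 < c) (hc1 : ∀ x, ‖x.1‖ ≤ c * r x) (hc2 : ∀ x, ‖x.2‖ ≤ c * r x ^ (α + 1))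
    (hw : Measurable w) (hw0 : ∀ x, 0 ≤ w x) (hw1 : ∀ x, w x ≤ 1)
    (hwd : ∀ t, 0 < t → ∀ x, w (dilation α t x) = w x)
    (hφ : ContDiff ℝ 1 φ) (hφc : HasCompactSupport φ) :
    ∫ x, r x ^ (-Q) * (w x * fderiv ℝ φ x (x.1, (α + 1) • x.2)) =
      -(Q * ∫ x in {x | r x < 1}, w x) * φ 0 := by
  have hdφ : Continuous (fderiv ℝ φ) := hφ.continuous_fderiv one_ne_zero
  obtain ⟨D, hD⟩ := hdφ.bounded_above_of_compact_support (hφc.fderiv (𝕜 := ℝ))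
  have hD0 : 0 ≤ D := (norm_nonneg _).trans (hD 0)
  obtain ⟨R₀, hR₀⟩ := hφc.isCompact.bddAbove_image (f := r) hr.continuousOn
  obtain ⟨R, hR, hR0⟩ : ∃ R, R₀ < R ∧ 0 < R :=
    ⟨max R₀ 0 + 1, by linarith [le_max_left R₀ 0], by linarith [le_max_right R₀ 0]⟩
  have hout : ∀ x, R ≤ r x → x ∉ tsupport φ := fun x hx h => by
    have := hR₀ ⟨x, h, rfl⟩
    linarith
  set M := D * (c * (1 + (α + 1) * R ^ α)) with hM
  have hM0 : 0 ≤ M := by positivity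
  set Zφ : Euc m × Euc k → ℝ := fun x => fderiv ℝ φ x (x.1, (α + 1) • x.2) with hZ
  have hZc : Continuous Zφ := hdφ.clm_apply (by fun_prop)
  have hZb : ∀ x, r x < R → |Zφ x| ≤ M * r x := by
    intro x hx
    have h1 := (fderiv ℝ φ x).le_of_opNorm_le (hD x) (x.1, (α + 1) • x.2)
    have h2 : ‖(x.1, (α + 1) • x.2)‖ ≤ ‖x.1‖ + (α + 1) * ‖x.2‖ := by
      rw [Prod.norm_mk, norm_smul, Real.norm_of_nonneg (by linarith)]
      exact max_le (le_add_of_nonneg_right (by positivity)) (le_add_of_nonneg_left (by positivity))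
    have h3 : r x ^ (α + 1) ≤ R ^ α * r x := by
      rcases (hrn x).eq_or_lt with h | h
      · rw [← h, Real.zero_rpow (by linarith), mul_zero]
      · rw [Real.rpow_add_one h.ne']
        gcongr
    refine h1.trans ?_
    rw [hM, mul_assoc D]
    refine mul_le_mul_of_nonneg_left (h2.trans ?_) hD0
    have h4 := hc2 x
    have h5 := hc1 x
    have h6 : ‖x.2‖ ≤ c * (R ^ α * r x) := h4.trans (by gcongr)
    have h7 : (α + 1) * ‖x.2‖ ≤ (α + 1) * (c * (R ^ α * r x)) := by gcongr
    linarith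
  have hZ0 : ∀ x, R ≤ r x → Zφ x = 0 := fun x hx => by
    simp [hZ, fderiv_of_notMem_tsupport ℝ (hout x hx)]
  have hφ0 : ∀ x, R ≤ r x → φ x = 0 := fun x hx => image_eq_zero_of_notMem_tsupport (hout x hx)
  have hbound : ∀ y, 0 < r y → ∀ t, 0 < t →
      |t⁻¹ * Zφ (dilation α t y)| ≤ (Set.Ioo 0 (R / r y)).indicator (fun _ => M * r y) t := by
    intro y hy t ht
    rcases lt_or_ge t (R / r y) with h | h
    · rw [Set.indicator_of_mem (show t ∈ Set.Ioo 0 (R / r y) from ⟨ht, h⟩), abs_mul,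
        abs_of_pos (inv_pos.mpr ht), inv_mul_le_iff₀ ht]
      have := hZb (dilation α t y) (by rw [hrd t ht]; rwa [lt_div_iff₀ hy] at h)
      rw [hrd t ht] at this
      linarith
    · rw [hZ0 _ (by rw [hrd t ht]; rwa [div_le_iff₀ hy] at h), mul_zero, abs_zero]
      exact Set.indicator_nonneg (fun _ _ => by positivity) t
  have hvol := volume_setOf_lt_one_lt_top hα hrn hc hc1 hc2
  have hfm : Measurable fun x => w x * Zφ x := hw.mul hZc.measurable
  have hdm : ∀ y : Euc m × Euc k, Measurable fun t => dilation α t y := 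
    fun y => (measurable_dilation α).comp measurable_prodMk_left
  have hdens : Measurable fun t : ℝ => ENNReal.ofReal (Q * t⁻¹) := by fun_prop
  have hint : Integrable
      (fun q : (Euc m × Euc k) × ℝ => w (dilation α q.2 q.1) * Zφ (dilation α q.2 q.1))
      ((volume.restrict {x | r x < 1}).prod
        ((volume.restrict (Set.Ioi 0)).withDensity fun t => ENNReal.ofReal (Q * t⁻¹))) := by
    have hFm : Measurable fun q : (Euc m × Euc k) × ℝ =>
        w (dilation α q.2 q.1) * Zφ (dilation α q.2 q.1) := hfm.comp (measurable_dilation α)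
    refine ⟨hFm.aestronglyMeasurable, ?_⟩
    rw [hasFiniteIntegral_iff_enorm, lintegral_prod _ hFm.enorm.aemeasurable]
    refine lt_of_le_of_lt (b := ∫⁻ _ in {x | r x < 1}, ENNReal.ofReal (Q * M * R)) ?_ ?_
    · refine lintegral_mono_ae ?_
      filter_upwards [ae_restrict_of_ae hr0] with y hy
      rw [lintegral_withDensity_eq_lintegral_mul _ hdens
        (show Measurable fun t => ‖w (dilation α t y) * Zφ (dilation α t y)‖ₑ from
          (hfm.comp (hdm y)).enorm)]
      calc _ ≤ ∫⁻ t in Set.Ioi (0 : ℝ),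
            (Set.Ioo 0 (R / r y)).indicator (fun _ => ENNReal.ofReal (Q * (M * r y))) t := by
            refine setLIntegral_mono' measurableSet_Ioi fun t ht => ?_
            have ht : 0 < t := ht
            have h1 := hbound y hy t ht
            simp only [Pi.mul_apply]
            rw [← ofReal_norm, ← ENNReal.ofReal_mul (by positivity), Real.norm_eq_abs,
              abs_mul, abs_of_nonneg (hw0 _)]
            have h2 : Q * t⁻¹ * (w (dilation α t y) * |Zφ (dilation α t y)|) ≤
                Q * |t⁻¹ * Zφ (dilation α t y)| := by
              rw [abs_mul, abs_of_pos (inv_pos.mpr ht), mul_assoc]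
              gcongr
              exact mul_le_of_le_one_left (abs_nonneg _) (hw1 _)
            refine (ENNReal.ofReal_le_ofReal (h2.trans
              (mul_le_mul_of_nonneg_left h1 hQ0.le))).trans ?_
            by_cases h : t ∈ Set.Ioo 0 (R / r y) <;> simp [h]
        _ = ENNReal.ofReal (Q * M * R) := by
            rw [lintegral_indicator measurableSet_Ioo, setLIntegral_const,
              Measure.restrict_apply measurableSet_Ioo,
              Set.inter_eq_left.mpr Set.Ioo_subset_Ioi_self, Real.volume_Ioo,
              ← ENNReal.ofReal_mul (by positivity)]
            congr 1
            field_simp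
            ring
        _ ≤ _ := le_rfl
    · rw [setLIntegral_const]
      exact ENNReal.mul_lt_top ENNReal.ofReal_lt_top hvol
  have hradial : ∀ y, 0 < r y → ∫ t in Set.Ioi (0 : ℝ), t⁻¹ * Zφ (dilation α t y) = -φ 0 := by
    intro y hy
    have hd0 : dilation α 0 y = 0 := by
      simp [dilation, Real.zero_rpow (show α + 1 ≠ 0 by linarith)]
    have hcont : Continuous fun t => dilation α t y := by
      have : Continuous fun t : ℝ => t ^ (α + 1) :=
        continuous_id.rpow_const fun _ => Or.inr (by linarith)
      unfold dilation
      fun_prop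
    have h := integral_Ioi_of_hasDerivAt_of_tendsto (f := fun t => φ (dilation α t y))
      (f' := fun t => t⁻¹ * Zφ (dilation α t y)) (a := 0) (m := 0)
      (hφ.continuous.comp hcont).continuousWithinAt ?_ ?_ ?_
    · rw [h]
      simp only [hd0, zero_sub]
    · intro t ht
      refine (((hφ.differentiable one_ne_zero _).hasFDerivAt).comp_hasDerivAt t
        (hasDerivAt_dilation α y ht)).congr_deriv ?_
      rw [map_smul, smul_eq_mul]
    · refine Integrable.mono' (g := (Set.Ioo 0 (R / r y)).indicator (fun _ => M * r y)) ?_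
        (measurable_inv.mul (hZc.measurable.comp (hdm y))).aestronglyMeasurable ?_
      · rw [integrable_indicator_iff measurableSet_Ioo]
        refine integrableOn_const ?_
        exact ((Measure.restrict_apply_le _ _).trans_lt (by simp)).ne
      · filter_upwards [ae_restrict_mem measurableSet_Ioi] with t ht using hbound y hy t ht
    · refine tendsto_const_nhds.congr' ?_
      filter_upwards [eventually_ge_atTop (R / r y)] with t ht
      have ht0 : 0 < t := lt_of_lt_of_le (by positivity) ht
      rw [hφ0 _ (by rw [hrd t ht0]; rwa [div_le_iff₀ hy] at ht)]
  have hpolar := map_dilation_prod hQ hQ0 hr.measurable hr0 hrd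
  have h1 : ∫ x, r x ^ (-Q) * (w x * Zφ x) =
      ∫ x, w x * Zφ x ∂(volume.withDensity fun x => ENNReal.ofReal (r x ^ (-Q))) := by
    rw [integral_withDensity_eq_integral_toReal_smul
      (by have := hr.measurable; fun_prop) (by simp)]
    refine integral_congr_ae (Eventually.of_forall fun x => ?_)
    simp only [ENNReal.toReal_ofReal (Real.rpow_nonneg (hrn x) _), smul_eq_mul]
  rw [h1, ← hpolar, integral_map (measurable_dilation α).aemeasurable hfm.aestronglyMeasurable,
    integral_prod _ hint]
  have h2 : ∀ᵐ y ∂volume.restrict {x | r x < 1},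
      ∫ t, w (dilation α t y) * Zφ (dilation α t y)
        ∂((volume.restrict (Set.Ioi 0)).withDensity fun t => ENNReal.ofReal (Q * t⁻¹)) =
      w y * -(Q * φ 0) := by
    filter_upwards [ae_restrict_of_ae hr0] with y hy
    rw [integral_withDensity_eq_integral_toReal_smul hdens (by simp),
      setIntegral_congr_fun (g := fun t => Q * w y * (t⁻¹ * Zφ (dilation α t y)))
        measurableSet_Ioi fun t ht => ?_, integral_const_mul, hradial y hy]
    · ring
    · have ht : 0 < t := ht
      simp only [ENNReal.toReal_ofReal (show 0 ≤ Q * t⁻¹ by positivity), smul_eq_mul, hwd t ht]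
      ring
  rw [integral_congr_ae h2, integral_mul_const]
  ring

section Gauge

variable {α : ℝ} {Φ : Euc m → ℝ} {Ψ : Euc k → ℝ}

lemma gauge_base_nonneg (hα : 0 < α) (hΦ : IsMinkowskiNorm Φ) (x : Euc m × Euc k) :
    0 ≤ dualNorm Φ x.1 ^ (2 * (α + 1)) + 4 * (α + 1) ^ 2 * dualNorm Ψ x.2 ^ 2 := by
  have := Real.rpow_nonneg (hΦ.dualNorm_nonneg x.1) (2 * (α + 1))
  positivity

lemma rho_nonneg (hα : 0 < α) (hΦ : IsMinkowskiNorm Φ) (x : Euc m × Euc k) :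
    0 ≤ rho α Φ Ψ x :=
  Real.rpow_nonneg (gauge_base_nonneg hα hΦ x) _

lemma rho_zero (hα : 0 < α) : rho α Φ Ψ 0 = 0 := by
  have h1 : 2 * (α + 1) ≠ 0 := by positivity
  have h2 : 1 / (2 * (α + 1)) ≠ 0 := by positivity
  simp only [rho, Prod.fst_zero, Prod.snd_zero, IsMinkowskiNorm.dualNorm_zero, Real.zero_rpow h1]
  norm_num [Real.zero_rpow, h1]
  rw [Real.zero_rpow]
  positivity

lemma continuous_rho (hα : 0 < α) (hΦ : IsMinkowskiNorm Φ) (hΨ : IsMinkowskiNorm Ψ) :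
    Continuous (rho α Φ Ψ) := by
  have h1 := hΦ.continuous_dualNorm
  have h2 := hΨ.continuous_dualNorm
  refine Continuous.rpow_const (Continuous.add (Continuous.rpow_const (by fun_prop) fun _ =>
    Or.inr (by positivity)) (by fun_prop)) fun _ => Or.inr (by positivity)

lemma rho_dilation (hα : 0 < α) (hΦ : IsMinkowskiNorm Φ) {t : ℝ} (ht : 0 < t)
    (x : Euc m × Euc k) : rho α Φ Ψ (dilation α t x) = t * rho α Φ Ψ x := by
  have h1 : t ^ (2 * (α + 1)) = (t ^ (α + 1)) ^ 2 := by
    rw [← Real.rpow_natCast, ← Real.rpow_mul ht.le, mul_comm]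
    norm_num
  have h2 : dualNorm Φ (dilation α t x).1 ^ (2 * (α + 1)) +
      4 * (α + 1) ^ 2 * dualNorm Ψ (dilation α t x).2 ^ 2 =
      t ^ (2 * (α + 1)) *
        (dualNorm Φ x.1 ^ (2 * (α + 1)) + 4 * (α + 1) ^ 2 * dualNorm Ψ x.2 ^ 2) := by
    rw [dilation, IsMinkowskiNorm.dualNorm_smul ht.le,
      IsMinkowskiNorm.dualNorm_smul (by positivity),
      Real.mul_rpow ht.le (hΦ.dualNorm_nonneg _), h1]
    ring
  rw [rho, h2, Real.mul_rpow (by positivity) (gauge_base_nonneg hα hΦ x), ← Real.rpow_mul ht.le,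
    mul_one_div_cancel (by positivity), Real.rpow_one, rho]

lemma dualNorm_fst_le_rho (hα : 0 < α) (hΦ : IsMinkowskiNorm Φ) (x : Euc m × Euc k) :
    dualNorm Φ x.1 ≤ rho α Φ Ψ x := by
  have h0 := hΦ.dualNorm_nonneg x.1
  calc dualNorm Φ x.1 = (dualNorm Φ x.1 ^ (2 * (α + 1))) ^ (1 / (2 * (α + 1))) := by
        rw [← Real.rpow_mul h0, mul_one_div_cancel (by positivity), Real.rpow_one]
    _ ≤ rho α Φ Ψ x :=
        Real.rpow_le_rpow (by positivity) (le_add_of_nonneg_right (by positivity)) (by positivity)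

lemma dualNorm_snd_le_rho (hα : 0 < α) (hΦ : IsMinkowskiNorm Φ) (hΨ : IsMinkowskiNorm Ψ)
    (x : Euc m × Euc k) : dualNorm Ψ x.2 ≤ rho α Φ Ψ x ^ (α + 1) := by
  have h0 := hΨ.dualNorm_nonneg x.2
  have h1 := Real.rpow_nonneg (hΦ.dualNorm_nonneg x.1) (2 * (α + 1))
  rw [rho, ← Real.rpow_mul (gauge_base_nonneg hα hΦ x),
    show 1 / (2 * (α + 1)) * (α + 1) = 1 / 2 by field_simp, ← Real.sqrt_eq_rpow]
  refine Real.le_sqrt_of_sq_le ?_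
  nlinarith [sq_nonneg (dualNorm Ψ x.2), mul_nonneg (by positivity : 0 ≤ α ^ 2 + 2 * α)
    (sq_nonneg (dualNorm Ψ x.2))]

end Gauge

lemma HasGradientAt.comp_hasDerivAt_left {n : ℕ} {f : Euc n → ℝ} {g x : Euc n} {h : ℝ → ℝ}
    {h' : ℝ} (hh : HasDerivAt h h' (f x)) (hf : HasGradientAt f g x) :
    HasGradientAt (fun y => h (f y)) (h' • g) x := by
  rw [hasGradientAt_iff_hasFDerivAt] at hf ⊢
  simpa [Function.comp_def] using hh.comp_hasFDerivAt x hf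

lemma inner_gradZ {φ : Euc m × Euc k → ℝ} {x : Euc m × Euc k} (hφ : DifferentiableAt ℝ φ x)
    (v : Euc m) : ⟪v, gradZ φ x⟫ = fderiv ℝ φ x (v, 0) := by
  have h : HasFDerivAt (fun z => φ (z, x.2))
      ((fderiv ℝ φ x).comp (ContinuousLinearMap.inl ℝ (Euc m) (Euc k))) x.1 :=
    HasFDerivAt.comp (f := fun z => (z, x.2)) x.1 hφ.hasFDerivAt (hasFDerivAt_prodMk_left x.1 x.2)
  rw [real_inner_comm, gradZ, gradient, InnerProductSpace.toDual_symm_apply, h.fderiv]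
  rfl

lemma inner_gradS {φ : Euc m × Euc k → ℝ} {x : Euc m × Euc k} (hφ : DifferentiableAt ℝ φ x)
    (v : Euc k) : ⟪v, gradS φ x⟫ = fderiv ℝ φ x (0, v) := by
  have h : HasFDerivAt (fun σ => φ (x.1, σ))
      ((fderiv ℝ φ x).comp (ContinuousLinearMap.inr ℝ (Euc m) (Euc k))) x.2 :=
    HasFDerivAt.comp (f := fun σ => (x.1, σ)) x.2 hφ.hasFDerivAt (hasFDerivAt_prodMk_right x.1 x.2)
  rw [real_inner_comm, gradS, gradient, InnerProductSpace.toDual_symm_apply, h.fderiv]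
  rfl

/-- The scalar identity behind the computation of the flux of a power of the gauge. -/
lemma flux_scalar_identity {α p Q A B s P L a b : ℝ} (hα : 0 < α) (hp : 1 < p) (hA : 0 < A)
    (hB : 0 < B) (hs : 0 < s) (hP : P = A ^ (2 * (α + 1)) + 4 * (α + 1) ^ 2 * B ^ 2)
    (hL : L = s ^ (-(1 / (p - 1))) * P ^ (-((Q - p) / (p - 1) / (2 * (α + 1))) - 1)) :
    ((L * A ^ (2 * α + 1)) ^ 2 + A ^ (2 * α) / 4 * (4 * (α + 1) * L * B) ^ 2) ^ ((p - 2) / 2) *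
      (L * A ^ (2 * α + 1) * (-(A⁻¹ * a)) +
        A ^ (2 * α) / 4 * (4 * (α + 1) * L * B) * (-(B⁻¹ * b))) =
    -s⁻¹ * ((P ^ (1 / (2 * (α + 1)))) ^ (-Q) *
      ((A / P ^ (1 / (2 * (α + 1)))) ^ (α * p) * (a + (α + 1) * b))) := by
  have hP0 : 0 < P := hP ▸ by positivity
  have hL0 : 0 < L := hL ▸ by positivity
  have hu : A ^ (2 * α + 1) = A ^ (2 * α) * A := Real.rpow_add_one hA.ne' _
  have hPu : P = A ^ (2 * α) * A ^ 2 + 4 * (α + 1) ^ 2 * B ^ 2 := by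
    rw [hP, ← Real.rpow_natCast A 2, ← Real.rpow_add hA]
    norm_num
    ring_nf
  have h1 : (L * A ^ (2 * α + 1)) ^ 2 + A ^ (2 * α) / 4 * (4 * (α + 1) * L * B) ^ 2 =
      L ^ 2 * (A ^ (2 * α) * P) := by
    rw [hu, hPu]
    ring
  have h2 : L * A ^ (2 * α + 1) * (-(A⁻¹ * a)) +
      A ^ (2 * α) / 4 * (4 * (α + 1) * L * B) * (-(B⁻¹ * b)) =
      -(L * A ^ (2 * α) * (a + (α + 1) * b)) := by
    rw [hu]
    field_simp
    ring
  have h3 : (L ^ 2 * (A ^ (2 * α) * P)) ^ ((p - 2) / 2) * (L * A ^ (2 * α)) =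
      s⁻¹ * ((P ^ (1 / (2 * (α + 1)))) ^ (-Q) * (A / P ^ (1 / (2 * (α + 1)))) ^ (α * p)) := by
    have hp1 : p - 1 ≠ 0 := by linarith
    refine Real.log_injOn_pos (Set.mem_Ioi.mpr (by positivity))
      (Set.mem_Ioi.mpr (by positivity)) ?_
    rw [Real.log_mul (by positivity) (by positivity), Real.log_rpow (by positivity),
      Real.log_mul (by positivity) (by positivity), Real.log_mul (by positivity) (by positivity),
      Real.log_mul (by positivity) (by positivity), Real.log_mul (by positivity) (by positivity),
      Real.log_mul (by positivity) (by positivity), Real.log_pow, Real.log_rpow hA, Real.log_inv,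
      Real.log_rpow (by positivity), Real.log_rpow hP0, Real.log_rpow (by positivity),
      Real.log_div (by positivity) (by positivity), Real.log_rpow hP0, hL,
      Real.log_mul (by positivity) (by positivity), Real.log_rpow hs, Real.log_rpow hP0]
    push_cast
    field_simp
    ring
  rw [h1, h2, mul_neg, ← mul_assoc, h3]
  ring

section GaugePower

variable {α : ℝ} {Φ : Euc m → ℝ} {Ψ : Euc k → ℝ}

lemma rho_rpow_neg (hα : 0 < α) (hΦ : IsMinkowskiNorm Φ) (β : ℝ) (x : Euc m × Euc k) :
    rho α Φ Ψ x ^ (-β) =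
      (dualNorm Φ x.1 ^ (2 * (α + 1)) + 4 * (α + 1) ^ 2 * dualNorm Ψ x.2 ^ 2) ^
        (-(β / (2 * (α + 1)))) := by
  rw [rho, ← Real.rpow_mul (gauge_base_nonneg hα hΦ x)]
  congr 1
  ring

lemma gradZ_const_mul_rho_rpow (hα : 0 < α) (hΦ : IsMinkowskiNorm Φ) (hm : 1 ≤ m) (c β : ℝ)
    {x : Euc m × Euc k} (hx : x.1 ≠ 0) {ξ : Euc m} (hξ : Φ ξ = 1)
    (hξx : ⟪x.1, ξ⟫ = dualNorm Φ x.1) :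
    gradZ (fun y => c * rho α Φ Ψ y ^ (-β)) x =
      -((c * β * (dualNorm Φ x.1 ^ (2 * (α + 1)) + 4 * (α + 1) ^ 2 * dualNorm Ψ x.2 ^ 2) ^
        (-(β / (2 * (α + 1))) - 1) * dualNorm Φ x.1 ^ (2 * α + 1)) • ξ) := by
  have hA := hΦ.dualNorm_pos hx
  have h1 : HasDerivAt (fun a : ℝ => a ^ (2 * (α + 1)) + 4 * (α + 1) ^ 2 * dualNorm Ψ x.2 ^ 2)
      (2 * (α + 1) * dualNorm Φ x.1 ^ (2 * (α + 1) - 1)) (dualNorm Φ x.1) :=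
    (Real.hasDerivAt_rpow_const (Or.inl hA.ne')).add_const _
  have h2 := (h1.rpow_const (p := -(β / (2 * (α + 1)))) (Or.inl (by positivity))).const_mul c
  simp only [gradZ, rho_rpow_neg hα hΦ]
  rw [(HasGradientAt.comp_hasDerivAt_left h2
    (hΦ.hasGradientAt_dualNorm hm hx hξ hξx)).gradient, ← neg_smul]
  congr 1
  rw [show 2 * (α + 1) - 1 = 2 * α + 1 by ring]
  field_simp

lemma gradS_const_mul_rho_rpow (hα : 0 < α) (hΦ : IsMinkowskiNorm Φ) (hΨ : IsMinkowskiNorm Ψ)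
    (hk : 1 ≤ k) (c β : ℝ) {x : Euc m × Euc k} (hx : x.2 ≠ 0) {η : Euc k} (hη : Ψ η = 1)
    (hηx : ⟪x.2, η⟫ = dualNorm Ψ x.2) :
    gradS (fun y => c * rho α Φ Ψ y ^ (-β)) x =
      -((4 * (α + 1) * (c * β * (dualNorm Φ x.1 ^ (2 * (α + 1)) +
        4 * (α + 1) ^ 2 * dualNorm Ψ x.2 ^ 2) ^ (-(β / (2 * (α + 1))) - 1)) *
          dualNorm Ψ x.2) • η) := by
  have hA := Real.rpow_nonneg (hΦ.dualNorm_nonneg x.1) (2 * (α + 1))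
  have hB := hΨ.dualNorm_pos hx
  have h1 : HasDerivAt
      (fun b : ℝ => dualNorm Φ x.1 ^ (2 * (α + 1)) + 4 * (α + 1) ^ 2 * b ^ 2)
      (4 * (α + 1) ^ 2 * (2 * dualNorm Ψ x.2)) (dualNorm Ψ x.2) := by
    simpa using ((hasDerivAt_pow 2 (dualNorm Ψ x.2)).const_mul (4 * (α + 1) ^ 2)).const_add
      (dualNorm Φ x.1 ^ (2 * (α + 1)))
  have h2 := (h1.rpow_const (p := -(β / (2 * (α + 1)))) (Or.inl (by positivity))).const_mul c
  simp only [gradS, rho_rpow_neg hα hΦ]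
  rw [(HasGradientAt.comp_hasDerivAt_left h2
    (hΨ.hasGradientAt_dualNorm hk hx hη hηx)).gradient, ← neg_smul]
  congr 1
  field_simp

/-- The flux of `c ρ^{-β}`, `β = (Q-p)/(p-1)`, is a multiple of the generator of the dilations. -/
lemma flux_const_mul_rho_rpow {p Q s c : ℝ} (hα : 0 < α) (hp : 1 < p)
    (hΦ : IsMinkowskiNorm Φ) (hΨ : IsMinkowskiNorm Ψ) (hm : 1 ≤ m) (hk : 1 ≤ k) (hs : 0 < s)
    (hc : c * ((Q - p) / (p - 1)) = s ^ (-(1 / (p - 1))))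
    {G : Euc m × Euc k → ℝ} (hG : G = fun y => c * rho α Φ Ψ y ^ (-((Q - p) / (p - 1))))
    {φ : Euc m × Euc k → ℝ} {x : Euc m × Euc k} (hφ : DifferentiableAt ℝ φ x)
    (hx1 : x.1 ≠ 0) (hx2 : x.2 ≠ 0) :
    (Φ (gradZ G x) ^ 2 + dualNorm Φ x.1 ^ (2 * α) / 4 * Ψ (gradS G x) ^ 2) ^ ((p - 2) / 2) *
        (Φ (gradZ G x) * ⟪gradient Φ (gradZ G x), gradZ φ x⟫ +
          dualNorm Φ x.1 ^ (2 * α) / 4 * Ψ (gradS G x) * ⟪gradient Ψ (gradS G x), gradS φ x⟫) =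
      -s⁻¹ * (rho α Φ Ψ x ^ (-Q) * ((dualNorm Φ x.1 / rho α Φ Ψ x) ^ (α * p) *
        fderiv ℝ φ x (x.1, (α + 1) • x.2))) := by
  obtain ⟨ξ, hξ, hξx⟩ := hΦ.exists_maximizer hm x.1
  obtain ⟨η, hη, hηx⟩ := hΨ.exists_maximizer hk x.2
  have hA := hΦ.dualNorm_pos hx1
  have hB := hΨ.dualNorm_pos hx2
  have hgen : fderiv ℝ φ x (x.1, (α + 1) • x.2) =
      fderiv ℝ φ x (x.1, 0) + (α + 1) * fderiv ℝ φ x (0, x.2) := by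
    rw [← smul_eq_mul, ← map_smul, ← map_add]
    simp
  rw [hG, gradZ_const_mul_rho_rpow hα hΦ hm _ _ hx1 hξ hξx,
    gradS_const_mul_rho_rpow hα hΦ hΨ hk _ _ hx2 hη hηx, hc]
  set P := dualNorm Φ x.1 ^ (2 * (α + 1)) + 4 * (α + 1) ^ 2 * dualNorm Ψ x.2 ^ 2 with hP
  set L := s ^ (-(1 / (p - 1))) * P ^ (-((Q - p) / (p - 1) / (2 * (α + 1))) - 1) with hL
  have hP0 : 0 < P := by positivity
  have hL0 : 0 < L := by positivity
  have hLA : 0 < L * dualNorm Φ x.1 ^ (2 * α + 1) := by positivity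
  have hLB : 0 < 4 * (α + 1) * L * dualNorm Ψ x.2 := by positivity
  rw [hΦ.gradient_neg_smul_maximizer hx1 hξ hξx hLA,
    hΨ.gradient_neg_smul_maximizer hx2 hη hηx hLB, hΦ.map_neg, hΨ.map_neg, hΦ.2.1, hΨ.2.1,
    hξ, hη, abs_of_pos hLA, abs_of_pos hLB, mul_one, mul_one, inner_neg_left, inner_neg_left,
    real_inner_smul_left, real_inner_smul_left, inner_gradZ hφ, inner_gradS hφ,
    flux_scalar_identity hα hp hA hB hs hP hL, hgen]
  rfl

end GaugePower

lemma ae_fst_ne_zero_snd_ne_zero (hm : 1 ≤ m) (hk : 1 ≤ k) :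
    ∀ᵐ x : Euc m × Euc k, x.1 ≠ 0 ∧ x.2 ≠ 0 := by
  have : NeZero m := ⟨by omega⟩
  have : NeZero k := ⟨by omega⟩
  have h1 : ∀ᵐ z : Euc m, z ≠ 0 := Measure.ae_ne volume 0
  have h2 : ∀ᵐ z : Euc k, z ≠ 0 := Measure.ae_ne volume 0
  exact (Measure.quasiMeasurePreserving_fst.ae h1).and (Measure.quasiMeasurePreserving_snd.ae h2)

/-- Theorem 1.6 (`p ≠ Q`): with `ω_{α,p} = ∫_{ρ<1}(Φ⁰(z)/ρ)^{αp}`, `σ_{α,p} = Qω_{α,p}`,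
`C_{α,p} = ((p−1)/(Q−p))σ_{α,p}^{−1/(p−1)}`, the function `𝒢 = C_{α,p} ρ^{−(Q−p)/(p−1)}`
is a fundamental solution of `−𝓛_{α,p}` with pole at the origin. -/
theorem fundamental_solution (m k : ℕ) (hm : 1 ≤ m) (hk : 1 ≤ k)
    (α : ℝ) (hα : 0 < α) (p : ℝ) (hp : 1 < p)
    (Φ : Euc m → ℝ) (Ψ : Euc k → ℝ) (hΦ : IsMinkowskiNorm Φ) (hΨ : IsMinkowskiNorm Ψ)
    (Q : ℝ) (hQ : Q = (m : ℝ) + (α + 1) * (k : ℝ)) (hpQ : p ≠ Q) (hQp : p < Q)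
    (ω σap C : ℝ)
    (hω : ω = ∫ x : Euc m × Euc k in {x | rho α Φ Ψ x < 1},
      (dualNorm Φ x.1 / rho α Φ Ψ x) ^ (α * p))
    (hσ : σap = Q * ω)
    (hC : C = (p - 1) / (Q - p) * σap ^ (-(1 / (p - 1))))
    (G : Euc m × Euc k → ℝ)
    (hG : ∀ x, G x = C * rho α Φ Ψ x ^ (-((Q - p) / (p - 1))))
    (φ : Euc m × Euc k → ℝ) (hφ : ContDiff ℝ (⊤ : ℕ∞) φ) (hφc : HasCompactSupport φ) :
    ∫ x : Euc m × Euc k,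
      (Φ (gradZ G x) ^ 2 + dualNorm Φ x.1 ^ (2 * α) / 4 * Ψ (gradS G x) ^ 2) ^ ((p - 2) / 2) *
        (Φ (gradZ G x) * ⟪gradient Φ (gradZ G x), gradZ φ x⟫ +
          dualNorm Φ x.1 ^ (2 * α) / 4 * Ψ (gradS G x) *
            ⟪gradient Ψ (gradS G x), gradS φ x⟫)
      = φ (0, 0) := by
  have hQ0 : 0 < Q := by linarith
  have hr := continuous_rho hα hΦ hΨ
  have hrn := rho_nonneg (Ψ := Ψ) hα hΦ
  have hne := ae_fst_ne_zero_snd_ne_zero hm hk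
  have hr0 : ∀ᵐ x : Euc m × Euc k, 0 < rho α Φ Ψ x := by
    filter_upwards [hne] with x hx
    exact (hΦ.dualNorm_pos hx.1).trans_le (dualNorm_fst_le_rho hα hΦ x)
  obtain ⟨a, ha, hza⟩ := hΦ.exists_norm_le_dualNorm
  obtain ⟨b, hb, hσb⟩ := hΨ.exists_norm_le_dualNorm
  have hc : 0 < max a b := lt_max_of_lt_left ha
  have hc1 (x : Euc m × Euc k) : ‖x.1‖ ≤ max a b * rho α Φ Ψ x :=
    (hza x.1).trans (mul_le_mul (le_max_left _ _) (dualNorm_fst_le_rho hα hΦ x)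
      (hΦ.dualNorm_nonneg _) hc.le)
  have hc2 (x : Euc m × Euc k) : ‖x.2‖ ≤ max a b * rho α Φ Ψ x ^ (α + 1) :=
    (hσb x.2).trans (mul_le_mul (le_max_right _ _) (dualNorm_snd_le_rho hα hΦ hΨ x)
      (hΨ.dualNorm_nonneg _) hc.le)
  set w : Euc m × Euc k → ℝ := fun x => (dualNorm Φ x.1 / rho α Φ Ψ x) ^ (α * p) with hw
  have hwm : Measurable w :=
    ((hΦ.continuous_dualNorm.measurable.comp measurable_fst).div hr.measurable).pow_const _
  have hdiv (x : Euc m × Euc k) : 0 ≤ dualNorm Φ x.1 / rho α Φ Ψ x :=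
    div_nonneg (hΦ.dualNorm_nonneg _) (hrn x)
  have hw0 (x : Euc m × Euc k) : 0 ≤ w x := Real.rpow_nonneg (hdiv x) _
  have hw1 (x : Euc m × Euc k) : w x ≤ 1 :=
    Real.rpow_le_one (hdiv x) (div_le_one_of_le₀ (dualNorm_fst_le_rho hα hΦ x) (hrn x))
      (by positivity)
  have hwd (t : ℝ) (ht : 0 < t) (x : Euc m × Euc k) : w (dilation α t x) = w x := by
    simp only [hw]
    rw [rho_dilation hα hΦ ht, dilation, IsMinkowskiNorm.dualNorm_smul ht.le,
      mul_div_mul_left _ _ ht.ne']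
  have hω0 : 0 < ω := by
    have hfin := volume_setOf_lt_one_lt_top hα hrn hc hc1 hc2
    have hint : IntegrableOn w {x | rho α Φ Ψ x < 1} :=
      Measure.integrableOn_of_bounded hfin.ne hwm.aestronglyMeasurable
        (Eventually.of_forall fun x => (Real.norm_of_nonneg (hw0 x)).trans_le (hw1 x))
    rw [hω, integral_pos_iff_support_of_nonneg hw0 hint]
    have hpos : 0 < volume {x | rho α Φ Ψ x < 1} :=
      (isOpen_lt hr continuous_const).measure_pos _ ⟨0, by simp [rho_zero hα]⟩
    have hsupp : Function.support w =ᵐ[volume.restrict {x | rho α Φ Ψ x < 1}] Set.univ := by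
      refine eventuallyEq_univ.mpr (ae_restrict_of_ae ?_)
      filter_upwards [hne, hr0] with x hx hx0
      exact (Real.rpow_pos_of_pos (div_pos (hΦ.dualNorm_pos hx.1) hx0) _).ne'
    rwa [measure_congr hsupp, Measure.restrict_apply_univ]
  have hs : 0 < σap := hσ ▸ mul_pos hQ0 hω0
  have hCs : C * ((Q - p) / (p - 1)) = σap ^ (-(1 / (p - 1))) := by
    have h1 : p - 1 ≠ 0 := by linarith
    have h2 : Q - p ≠ 0 := by linarith
    rw [hC]
    field_simp
  rw [integral_congr_ae (hne.mono fun x hx => flux_const_mul_rho_rpow hα hp hΦ hΨ hm hk hs hCs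
      (funext hG) (hφ.differentiable (by simp) x) hx.1 hx.2), integral_const_mul,
    integral_rpow_mul_fderiv_generator hα hQ hQ0 hr hr0 hrn (fun t ht => rho_dilation hα hΦ ht)
      hc hc1 hc2 hwm hw0 hw1 hwd (hφ.of_le (by simp)) hφc, ← hω, ← hσ, neg_mul,
    neg_mul, mul_neg, neg_neg, inv_mul_cancel_left₀ hs.ne']
  rfl
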